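/- arXiv:1210.6256 — 2 statements merged into one kernel-verified Lean document; each statement's English description precedes it below -/
import Mathlib

section
/- Let K be a nondegenerate tetrahedron in ℝ³ with vertices v₁,…,v₄, let i ≠ j be two indices, let f_i and f_j be the faces of K opposite v_i and v_j, and let e be their common edge, with endpoints v_k and v_l. Then for any β, γ ∈ ℝ there exists a unique polynomial p of total degree ≤ 2 on K satisfying: (1) the restriction of p to e is affine; (2) p(v_k) = β and p(v_l) = γ; (3) ∫_{f_i} p q ds = 0 and ∫_{f_j} p q ds = 0 for every affine function q (integrals with respect to 2-dimensional surface measure on the faces); (4) ∫_K p dx = 0. Moreover this p satisfies p(v_i) = p(v_j) = 3(β+γ)/2. -/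
open MeasureTheory RealInnerProductSpace Matrix

noncomputable section

abbrev E3 := EuclideanSpace ℝ (Fin 3)

/-- `p` is (the restriction of) a real polynomial of total degree ≤ k on ℝ³. -/
def IsPolyLE (k : ℕ) (p : E3 → ℝ) : Prop :=
  ∃ P : MvPolynomial (Fin 3) ℝ, P.totalDegree ≤ k ∧ ∀ x, p x = MvPolynomial.eval (fun i => x i) P

/-- `p` agrees with an affine function on the set `s`. -/
def AffineOn (s : Set E3) (p : E3 → ℝ) : Prop :=
  ∃ q : E3 →ᵃ[ℝ] ℝ, ∀ x ∈ s, p x = q x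

def Tet (v : Fin 4 → E3) : Set E3 := convexHull ℝ (Set.range v)

def Face (v : Fin 4 → E3) (i : Fin 4) : Set E3 := convexHull ℝ (v '' {j | j ≠ i})

def Edge (v : Fin 4 → E3) (k l : Fin 4) : Set E3 := segment ℝ (v k) (v l)

/-- The four conditions of the lemma on a quadratic polynomial `p`:
(1) `p` is affine on the edge `e = [v_k, v_l]`; (2) `p(v_k) = β`, `p(v_l) = γ`;
(3) `p|_{f_i} ⊥ P₁(f_i)` and `p|_{f_j} ⊥ P₁(f_j)` (surface measure);
(4) `∫_K p dx = 0`. -/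
def LemCond (v : Fin 4 → E3) (i j k l : Fin 4) (β γ : ℝ) (p : E3 → ℝ) : Prop :=
  IsPolyLE 2 p ∧
  AffineOn (Edge v k l) p ∧
  p (v k) = β ∧ p (v l) = γ ∧
  (∀ q : E3 →ᵃ[ℝ] ℝ, ∫ x in Face v i, p x * q x ∂μH[2] = 0) ∧
  (∀ q : E3 →ᵃ[ℝ] ℝ, ∫ x in Face v j, p x * q x ∂μH[2] = 0) ∧
  (∫ x in Tet v, p x) = 0


/-! ### Closure properties of polynomial functions -/

lemma IsPolyLE.add' {k : ℕ} {p q : E3 → ℝ} (hp : IsPolyLE k p) (hq : IsPolyLE k q) :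
    IsPolyLE k (fun x => p x + q x) := by
  obtain ⟨P, hP, hp⟩ := hp
  obtain ⟨Q, hQ, hq⟩ := hq
  refine ⟨P + Q, (MvPolynomial.totalDegree_add _ _).trans (max_le hP hQ), fun x => ?_⟩
  simp [hp, hq]

lemma IsPolyLE.mul' {k m : ℕ} {p q : E3 → ℝ} (hp : IsPolyLE k p) (hq : IsPolyLE m q) :
    IsPolyLE (k + m) (fun x => p x * q x) := by
  obtain ⟨P, hP, hp⟩ := hp
  obtain ⟨Q, hQ, hq⟩ := hq
  refine ⟨P * Q, (MvPolynomial.totalDegree_mul _ _).trans (add_le_add hP hQ), fun x => ?_⟩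
  simp [hp, hq]

lemma IsPolyLE.mono' {k m : ℕ} (h : k ≤ m) {p : E3 → ℝ} (hp : IsPolyLE k p) :
    IsPolyLE m p := by
  obtain ⟨P, hP, hp⟩ := hp
  exact ⟨P, hP.trans h, hp⟩

lemma isPolyLE_affine (q : E3 →ᵃ[ℝ] ℝ) : IsPolyLE 1 q := by
  refine ⟨MvPolynomial.C (q 0) + ∑ i : Fin 3,
    MvPolynomial.C (q.linear (EuclideanSpace.single i 1)) * MvPolynomial.X i, ?_, fun x => ?_⟩
  · refine (MvPolynomial.totalDegree_add _ _).trans (max_le (by simp) ?_)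
    refine MvPolynomial.totalDegree_finsetSum_le fun i _ => ?_
    refine (MvPolynomial.totalDegree_mul _ _).trans ?_
    simp
  · have h1 : q x = q.linear x + q 0 := by
      simpa using congrFun (AffineMap.decomp q) x
    have h2 : x = ∑ i : Fin 3, x i • (EuclideanSpace.single i (1 : ℝ) : E3) := by
      ext j
      fin_cases j <;> simp [Fin.sum_univ_three]
    rw [h1]
    conv_lhs => rw [h2]
    simp only [map_sum, map_smul, smul_eq_mul, map_add, map_mul, MvPolynomial.eval_C,
      MvPolynomial.eval_X]
    rw [add_comm]
    congr 1
    exact Finset.sum_congr rfl fun i _ => mul_comm _ _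

/-! ### Barycentric data -/

/-- Points with barycentric coordinate functions. -/
structure Bary (w : Fin 4 → E3) (lam : Fin 4 → (E3 →ᵃ[ℝ] ℝ)) : Prop where
  val : ∀ a b, lam a (w b) = if a = b then 1 else 0
  sum_one : ∀ x, ∑ a, lam a x = 1
  aff : ∀ (q : E3 →ᵃ[ℝ] ℝ) (x : E3), q x = ∑ a, q (w a) * lam a x

lemma exists_bary (w : Fin 4 → E3) (hw : AffineIndependent ℝ w) : ∃ lam, Bary w lam := by
  have htop : affineSpan ℝ (Set.range w) = ⊤ := by
    rw [hw.affineSpan_eq_top_iff_card_eq_finrank_add_one]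
    simp
  let b : AffineBasis (Fin 4) ℝ E3 := ⟨w, hw, htop⟩
  refine ⟨fun a => b.coord a, ?_, ?_, ?_⟩
  · intro a c
    exact b.coord_apply a c
  · intro x
    exact b.sum_coord_apply_eq_one x
  · intro q x
    have h := b.affineCombination_coord_eq_self x
    conv_lhs => rw [← h]
    rw [Finset.map_affineCombination _ _ _ (b.sum_coord_apply_eq_one x)]
    rw [Finset.affineCombination_eq_linear_combination _ _ _ (b.sum_coord_apply_eq_one x)]
    exact Finset.sum_congr rfl fun i _ => mul_comm _ _

lemma Bary.quad {w lam} (h : Bary w lam) {p : E3 → ℝ} (hp : IsPolyLE 2 p) :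
    ∃ A : Fin 4 → Fin 4 → ℝ, ∀ x, p x = ∑ a, ∑ b, A a b * (lam a x * lam b x) := by
  have hmul : ∀ q r : E3 →ᵃ[ℝ] ℝ,
      ∃ A : Fin 4 → Fin 4 → ℝ, ∀ x, q x * r x = ∑ a, ∑ b, A a b * (lam a x * lam b x) := by
    intro q r
    refine ⟨fun a b => q (w a) * r (w b), fun x => ?_⟩
    rw [h.aff q x, h.aff r x, Finset.sum_mul_sum]
    exact Finset.sum_congr rfl fun i _ => Finset.sum_congr rfl fun j _ => by ring
  obtain ⟨P, hP, hp⟩ := hp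
  have key : ∀ m ∈ P.support, ∃ A : Fin 4 → Fin 4 → ℝ, ∀ x : E3,
      P.coeff m * ∏ i, (x i) ^ m i = ∑ a, ∑ b, A a b * (lam a x * lam b x) := by
    intro m hm
    have hdeg : m 0 + m 1 + m 2 ≤ 2 := by
      have := MvPolynomial.le_totalDegree hm
      rw [Finsupp.sum_fintype _ _ (fun _ => rfl), Fin.sum_univ_three] at this
      exact this.trans hP
    let pr : Fin 3 → (E3 →ᵃ[ℝ] ℝ) := fun i =>
      (EuclideanSpace.proj i : E3 →L[ℝ] ℝ).toLinearMap.toAffineMap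
    let one : E3 →ᵃ[ℝ] ℝ := AffineMap.const ℝ E3 1
    have hpr : ∀ i x, pr i x = x i := fun i x => rfl
    have hone : ∀ x, one x = 1 := fun x => rfl
    have : ∃ q r : E3 →ᵃ[ℝ] ℝ, ∀ x : E3, ∏ i, (x i) ^ m i = q x * r x := by
      simp only [Fin.prod_univ_three]
      generalize m 0 = m0 at *
      generalize m 1 = m1 at *
      generalize m 2 = m2 at *
      have h0 : m0 ≤ 2 := by omega
      have h1 : m1 ≤ 2 := by omega
      have h2 : m2 ≤ 2 := by omega
      interval_cases m0 <;> interval_cases m1 <;> interval_cases m2 <;> first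
        | (exfalso; omega)
        | (refine ⟨one, one, fun x => ?_⟩; simp [hone]; done)
        | (refine ⟨pr 0, one, fun x => ?_⟩; simp [hone, hpr]; done)
        | (refine ⟨pr 1, one, fun x => ?_⟩; simp [hone, hpr]; done)
        | (refine ⟨pr 2, one, fun x => ?_⟩; simp [hone, hpr]; done)
        | (refine ⟨pr 0, pr 0, fun x => ?_⟩; simp only [hpr]; ring; done)
        | (refine ⟨pr 1, pr 1, fun x => ?_⟩; simp only [hpr]; ring; done)
        | (refine ⟨pr 2, pr 2, fun x => ?_⟩; simp only [hpr]; ring; done)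
        | (refine ⟨pr 0, pr 1, fun x => ?_⟩; simp [hpr]; done)
        | (refine ⟨pr 0, pr 2, fun x => ?_⟩; simp [hpr]; done)
        | (refine ⟨pr 1, pr 2, fun x => ?_⟩; simp [hpr]; done)
    obtain ⟨q, r, hqr⟩ := this
    obtain ⟨A, hA⟩ := hmul q r
    refine ⟨fun a b => P.coeff m * A a b, fun x => ?_⟩
    rw [hqr, hA, Finset.mul_sum]
    refine Finset.sum_congr rfl fun i _ => ?_
    rw [Finset.mul_sum]
    exact Finset.sum_congr rfl fun j _ => by ring
  choose! A hA using key
  refine ⟨fun a b => ∑ m ∈ P.support, A m a b, fun x => ?_⟩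
  rw [hp, MvPolynomial.eval_eq', Finset.sum_congr rfl (fun m hm => hA m hm x), Finset.sum_comm]
  refine Finset.sum_congr rfl fun i _ => ?_
  rw [Finset.sum_comm]
  refine Finset.sum_congr rfl fun j _ => ?_
  rw [Finset.sum_mul]

/-- Normal form of a quadratic. -/
lemma Bary.quad' {w lam} (h : Bary w lam) {p : E3 → ℝ} (hp : IsPolyLE 2 p) :
    ∃ c0 c1 c2 c3 d01 d02 d03 d12 d13 d23 : ℝ, ∀ x, p x =
      c0 * lam 0 x + c1 * lam 1 x + c2 * lam 2 x + c3 * lam 3 x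
      + d01 * (lam 0 x * lam 1 x) + d02 * (lam 0 x * lam 2 x) + d03 * (lam 0 x * lam 3 x)
      + d12 * (lam 1 x * lam 2 x) + d13 * (lam 1 x * lam 3 x) + d23 * (lam 2 x * lam 3 x) := by
  obtain ⟨A, hA⟩ := h.quad hp
  refine ⟨A 0 0, A 1 1, A 2 2, A 3 3, A 0 1 + A 1 0 - A 0 0 - A 1 1,
    A 0 2 + A 2 0 - A 0 0 - A 2 2, A 0 3 + A 3 0 - A 0 0 - A 3 3,
    A 1 2 + A 2 1 - A 1 1 - A 2 2, A 1 3 + A 3 1 - A 1 1 - A 3 3,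
    A 2 3 + A 3 2 - A 2 2 - A 3 3, fun x => ?_⟩
  have h1 := h.sum_one x
  rw [Fin.sum_univ_four] at h1
  rw [hA]
  simp only [Fin.sum_univ_four]
  have h3 : lam 3 x = 1 - lam 0 x - lam 1 x - lam 2 x := by linarith
  rw [h3]
  ring

lemma aff_add (q : E3 →ᵃ[ℝ] ℝ) (x y : E3) : q (x + y) = q x + q.linear y := by
  have := q.map_vadd x y
  simp only [vadd_eq_add] at this
  rw [add_comm x y, this, add_comm]

lemma aff_lin (q : E3 →ᵃ[ℝ] ℝ) (x y : E3) : q.linear (x - y) = q x - q y := by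
  have := q.linearMap_vsub x y
  simpa using this

/-! ### Reference simplices -/

def T2 : Set (ℝ × ℝ) := {z | 0 ≤ z.1 ∧ 0 ≤ z.2 ∧ z.1 + z.2 ≤ 1}

def T3 : Set (ℝ × ℝ × ℝ) := {z | 0 ≤ z.1 ∧ 0 ≤ z.2.1 ∧ 0 ≤ z.2.2 ∧ z.1 + z.2.1 + z.2.2 ≤ 1}

lemma T2_convex : Convex ℝ T2 := by
  rintro ⟨a, b⟩ ⟨h1, h2, h3⟩ ⟨c, d⟩ ⟨h4, h5, h6⟩ r s hr hs hrs
  simp only at h1 h2 h3 h4 h5 h6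
  refine ⟨?_, ?_, ?_⟩ <;> simp only [Prod.smul_mk, Prod.mk_add_mk, smul_eq_mul]
  · positivity
  · positivity
  · nlinarith

lemma T3_convex : Convex ℝ T3 := by
  rintro ⟨a, b, e⟩ ⟨h1, h2, h3, h7⟩ ⟨c, d, f⟩ ⟨h4, h5, h6, h8⟩ r s hr hs hrs
  simp only at h1 h2 h3 h4 h5 h6 h7 h8
  refine ⟨?_, ?_, ?_, ?_⟩ <;> simp only [Prod.smul_mk, Prod.mk_add_mk, smul_eq_mul]
  · positivity
  · positivity
  · positivity
  · nlinarith

lemma T2_compact : IsCompact T2 := by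
  refine (isCompact_Icc (a := ((0 : ℝ), (0 : ℝ))) (b := (1, 1))).of_isClosed_subset ?_ ?_
  · have e : T2 = {z : ℝ × ℝ | 0 ≤ z.1} ∩ ({z | 0 ≤ z.2} ∩ {z | z.1 + z.2 ≤ 1}) := rfl
    rw [e]
    refine IsClosed.inter ?_ (IsClosed.inter ?_ ?_) <;>
    exact isClosed_le (by fun_prop) (by fun_prop)
  · rintro ⟨a, b⟩ ⟨h1, h2, h3⟩
    simp only at h1 h2 h3
    exact ⟨⟨h1, h2⟩, ⟨by simp only; linarith, by simp only; linarith⟩⟩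

lemma T3_compact : IsCompact T3 := by
  refine (isCompact_Icc (a := ((0 : ℝ), (0 : ℝ), (0 : ℝ))) (b := (1, 1, 1))).of_isClosed_subset ?_ ?_
  · have e : T3 = {z : ℝ × ℝ × ℝ | 0 ≤ z.1} ∩ ({z | 0 ≤ z.2.1} ∩ ({z | 0 ≤ z.2.2} ∩
        {z | z.1 + z.2.1 + z.2.2 ≤ 1})) := rfl
    rw [e]
    refine IsClosed.inter ?_ (IsClosed.inter ?_ (IsClosed.inter ?_ ?_)) <;>
    exact isClosed_le (by fun_prop) (by fun_prop)
  · rintro ⟨a, b, c⟩ ⟨h1, h2, h3, h4⟩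
    simp only at h1 h2 h3 h4
    exact ⟨⟨h1, h2, h3⟩, ⟨by simp only; linarith, by simp only; linarith, by simp only; linarith⟩⟩

lemma T2_int (g : ℝ × ℝ → ℝ) (hg : Continuous g) :
    ∫ z in T2, g z = ∫ s in (0 : ℝ)..1, ∫ t in (0 : ℝ)..(1 - s), g (s, t) := by
  have hm : MeasurableSet T2 := T2_compact.measurableSet
  have hi : Integrable (T2.indicator g) :=
    (integrable_indicator_iff hm).2 (hg.continuousOn.integrableOn_compact T2_compact)
  rw [← integral_indicator hm, Measure.volume_eq_prod, integral_prod _ hi,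
    intervalIntegral.integral_of_le zero_le_one, ← integral_Icc_eq_integral_Ioc,
    ← integral_indicator measurableSet_Icc]
  refine integral_congr_ae (Filter.Eventually.of_forall fun s => ?_)
  by_cases hs : s ∈ Set.Icc (0 : ℝ) 1
  · simp only [Set.indicator_of_mem hs]
    rw [intervalIntegral.integral_of_le (by linarith [hs.2]), ← integral_Icc_eq_integral_Ioc,
      ← integral_indicator measurableSet_Icc]
    refine integral_congr_ae (Filter.Eventually.of_forall fun t => ?_)
    have : (s, t) ∈ T2 ↔ t ∈ Set.Icc (0 : ℝ) (1 - s) := by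
      simp only [T2, Set.mem_ofPred_eq, Set.mem_Icc]
      constructor
      · rintro ⟨a, b, c⟩; exact ⟨b, by linarith⟩
      · rintro ⟨a, b⟩; exact ⟨hs.1, a, by linarith⟩
    simp only [Set.indicator, this]
  · simp only [Set.indicator_of_notMem hs]
    have : ∀ t, T2.indicator g (s, t) = 0 := by
      intro t
      refine Set.indicator_of_notMem ?_ _
      rintro ⟨a, b, c⟩
      simp only at a b c
      exact hs ⟨a, by linarith⟩
    simp [this]

lemma T3_int (g : ℝ × ℝ × ℝ → ℝ) (hg : Continuous g) :
    ∫ z in T3, g z = ∫ s in (0 : ℝ)..1, ∫ t in (0 : ℝ)..(1 - s),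
      ∫ u in (0 : ℝ)..(1 - s - t), g (s, t, u) := by
  have hm : MeasurableSet T3 := T3_compact.measurableSet
  have hi : Integrable (T3.indicator g) :=
    (integrable_indicator_iff hm).2 (hg.continuousOn.integrableOn_compact T3_compact)
  rw [← integral_indicator hm, Measure.volume_eq_prod, integral_prod _ hi,
    intervalIntegral.integral_of_le zero_le_one, ← integral_Icc_eq_integral_Ioc,
    ← integral_indicator measurableSet_Icc]
  refine integral_congr_ae (Filter.Eventually.of_forall fun s => ?_)
  by_cases hs : s ∈ Set.Icc (0 : ℝ) 1
  · simp only [Set.indicator_of_mem hs]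
    let S : Set (ℝ × ℝ) := {z | 0 ≤ z.1 ∧ 0 ≤ z.2 ∧ s + z.1 + z.2 ≤ 1}
    have hSc : IsCompact S := by
      refine (isCompact_Icc (a := ((0 : ℝ), (0 : ℝ))) (b := (1, 1))).of_isClosed_subset ?_ ?_
      · have e : S = {z : ℝ × ℝ | 0 ≤ z.1} ∩ ({z | 0 ≤ z.2} ∩ {z | s + z.1 + z.2 ≤ 1}) := rfl
        rw [e]
        refine IsClosed.inter ?_ (IsClosed.inter ?_ ?_) <;>
        exact isClosed_le (by fun_prop) (by fun_prop)
      · rintro ⟨a, b⟩ ⟨h1, h2, h3⟩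
        simp only at h1 h2 h3
        have := hs.1
        exact ⟨⟨h1, h2⟩, ⟨by simp only; linarith, by simp only; linarith⟩⟩
    have hgs : Continuous fun z : ℝ × ℝ => g (s, z) := by fun_prop
    have hi2 : Integrable (S.indicator fun z : ℝ × ℝ => g (s, z)) :=
      (integrable_indicator_iff hSc.measurableSet).2 (hgs.continuousOn.integrableOn_compact hSc)
    have e1 : ∀ z, T3.indicator g (s, z) = S.indicator (fun z : ℝ × ℝ => g (s, z)) z := by
      intro z
      have : (s, z) ∈ T3 ↔ z ∈ S := by
        simp only [T3, S, Set.mem_ofPred_eq]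
        exact ⟨fun h => h.2, fun h => ⟨hs.1, h⟩⟩
      simp only [Set.indicator, this]
    simp only [e1]
    rw [Measure.volume_eq_prod, integral_prod _ hi2]
    rw [intervalIntegral.integral_of_le (by linarith [hs.2]), ← integral_Icc_eq_integral_Ioc,
      ← integral_indicator measurableSet_Icc]
    refine integral_congr_ae (Filter.Eventually.of_forall fun t => ?_)
    by_cases ht : t ∈ Set.Icc (0 : ℝ) (1 - s)
    · simp only [Set.indicator_of_mem ht]
      rw [intervalIntegral.integral_of_le (by linarith [ht.2]), ← integral_Icc_eq_integral_Ioc,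
        ← integral_indicator measurableSet_Icc]
      refine integral_congr_ae (Filter.Eventually.of_forall fun u => ?_)
      have : (t, u) ∈ S ↔ u ∈ Set.Icc (0 : ℝ) (1 - s - t) := by
        simp only [S, Set.mem_ofPred_eq, Set.mem_Icc]
        constructor
        · rintro ⟨a, b, c⟩; exact ⟨b, by linarith⟩
        · rintro ⟨a, b⟩; exact ⟨ht.1, a, by linarith⟩
      simp only [Set.indicator, this]
    · simp only [Set.indicator_of_notMem ht]
      have : ∀ u, S.indicator (fun z : ℝ × ℝ => g (s, z)) (t, u) = 0 := by
        intro u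
        refine Set.indicator_of_notMem ?_ _
        rintro ⟨a, b, c⟩
        simp only at a b c
        exact ht ⟨a, by linarith⟩
      simp [this]
  · simp only [Set.indicator_of_notMem hs]
    have : ∀ t, T3.indicator g (s, t) = 0 := by
      intro t
      refine Set.indicator_of_notMem ?_ _
      rintro ⟨a, b, c, d⟩
      simp only at a b c d
      exact hs ⟨a, by linarith⟩
    simp [this]

lemma poly4_int (c0 c1 c2 c3 c4 b : ℝ) :
    ∫ x in (0 : ℝ)..b, (c0 + c1 * x + c2 * x ^ 2 + c3 * x ^ 3 + c4 * x ^ 4) =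
      c0 * b + c1 * b ^ 2 / 2 + c2 * b ^ 3 / 3 + c3 * b ^ 4 / 4 + c4 * b ^ 5 / 5 := by
  have hd : ∀ x : ℝ, HasDerivAt (fun b : ℝ =>
      c0 * b + c1 / 2 * b ^ 2 + c2 / 3 * b ^ 3 + c3 / 4 * b ^ 4 + c4 / 5 * b ^ 5)
      (c0 + c1 * x + c2 * x ^ 2 + c3 * x ^ 3 + c4 * x ^ 4) x := by
    intro x
    have := (((((hasDerivAt_id x).const_mul c0).add ((hasDerivAt_pow 2 x).const_mul (c1 / 2))).add
      ((hasDerivAt_pow 3 x).const_mul (c2 / 3))).add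
      ((hasDerivAt_pow 4 x).const_mul (c3 / 4))).add ((hasDerivAt_pow 5 x).const_mul (c4 / 5))
    refine HasDerivAt.congr_deriv this ?_
    norm_num
    ring
  rw [intervalIntegral.integral_eq_sub_of_hasDerivAt (fun x _ => hd x)
    (Continuous.intervalIntegrable (by fun_prop) _ _)]
  ring

lemma poly4_int' (f : ℝ → ℝ) (b c0 c1 c2 c3 c4 : ℝ)
    (hf : ∀ x, f x = c0 + c1 * x + c2 * x ^ 2 + c3 * x ^ 3 + c4 * x ^ 4) :
    ∫ x in (0 : ℝ)..b, f x =
      c0 * b + c1 * b ^ 2 / 2 + c2 * b ^ 3 / 3 + c3 * b ^ 4 / 4 + c4 * b ^ 5 / 5 := by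
  rw [← poly4_int]
  simp only [hf]

/-- Iterated integral of a cubic. -/
lemma iter_int (f : ℝ → ℝ → ℝ) (a00 a10 a01 a20 a11 a02 a30 a21 a12 a03 : ℝ)
    (hf : ∀ s t, f s t = a00 + a10 * s + a01 * t + a20 * s ^ 2 + a11 * s * t + a02 * t ^ 2
      + a30 * s ^ 3 + a21 * s ^ 2 * t + a12 * s * t ^ 2 + a03 * t ^ 3) :
    ∫ s in (0 : ℝ)..1, ∫ t in (0 : ℝ)..(1 - s), f s t =
      a00 / 2 + (a10 + a01) / 6 + (2 * a20 + a11 + 2 * a02) / 24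
      + (6 * a30 + 2 * a21 + 2 * a12 + 6 * a03) / 120 := by
  have h1 : ∀ s, ∫ t in (0 : ℝ)..(1 - s), f s t =
      (a00 + a10 * s + a20 * s ^ 2 + a30 * s ^ 3) * (1 - s)
      + (a01 + a11 * s + a21 * s ^ 2) * (1 - s) ^ 2 / 2
      + (a02 + a12 * s) * (1 - s) ^ 3 / 3 + a03 * (1 - s) ^ 4 / 4 + 0 * (1 - s) ^ 5 / 5 :=
    fun s => poly4_int' _ _ _ _ _ _ _ fun t => by rw [hf]; ring
  simp only [h1]
  rw [poly4_int' _ 1 (a00 + a01 / 2 + a02 / 3 + a03 / 4)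
    (a10 - a00 + (a11 - 2 * a01) / 2 + (a12 - 3 * a02) / 3 - a03)
    (a20 - a10 + (a21 - 2 * a11 + a01) / 2 + (3 * a02 - 3 * a12) / 3 + 6 * a03 / 4)
    (a30 - a20 + (a11 - 2 * a21) / 2 + (3 * a12 - a02) / 3 - a03)
    (-a30 + a21 / 2 - a12 / 3 + a03 / 4) (fun s => by ring)]
  ring

lemma tri_int (x1 x2 x3 d12 d13 d23 y1 y2 y3 : ℝ) :
    ∫ z in T2, (x1 * z.1 + x2 * z.2 + x3 * (1 - z.1 - z.2) + d12 * (z.1 * z.2)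
        + d13 * (z.1 * (1 - z.1 - z.2)) + d23 * (z.2 * (1 - z.1 - z.2)))
        * (y1 * z.1 + y2 * z.2 + y3 * (1 - z.1 - z.2)) =
      y1 * (x1 / 12 + (x2 + x3) / 24 + (2 * d12 + 2 * d13 + d23) / 120)
      + y2 * (x2 / 12 + (x1 + x3) / 24 + (2 * d12 + d13 + 2 * d23) / 120)
      + y3 * (x3 / 12 + (x1 + x2) / 24 + (d12 + 2 * d13 + 2 * d23) / 120) := by
  rw [T2_int _ (by fun_prop)]
  rw [iter_int _ (x3 * y3) (x3 * (y1 - y3) + (x1 - x3 + d13) * y3)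
    (x3 * (y2 - y3) + (x2 - x3 + d23) * y3)
    ((x1 - x3 + d13) * (y1 - y3) - d13 * y3)
    ((x1 - x3 + d13) * (y2 - y3) + (x2 - x3 + d23) * (y1 - y3) + (d12 - d13 - d23) * y3)
    ((x2 - x3 + d23) * (y2 - y3) - d23 * y3)
    (- d13 * (y1 - y3)) (- d13 * (y2 - y3) + (d12 - d13 - d23) * (y1 - y3))
    (- d23 * (y1 - y3) + (d12 - d13 - d23) * (y2 - y3))
    (- d23 * (y2 - y3)) (fun s t => by ring)]
  ring

lemma tet_int (c0 c1 c2 c3 d01 d02 d03 d12 d13 d23 : ℝ) :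
    ∫ z in T3, (c0 * z.1 + c1 * z.2.1 + c2 * z.2.2 + c3 * (1 - z.1 - z.2.1 - z.2.2)
      + d01 * (z.1 * z.2.1) + d02 * (z.1 * z.2.2) + d03 * (z.1 * (1 - z.1 - z.2.1 - z.2.2))
      + d12 * (z.2.1 * z.2.2) + d13 * (z.2.1 * (1 - z.1 - z.2.1 - z.2.2))
      + d23 * (z.2.2 * (1 - z.1 - z.2.1 - z.2.2))) =
      (c0 + c1 + c2 + c3) / 24 + (d01 + d02 + d03 + d12 + d13 + d23) / 120 := by
  rw [T3_int _ (by fun_prop)]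
  have h1 : ∀ s t : ℝ, (∫ u in (0 : ℝ)..(1 - s - t),
      (c0 * s + c1 * t + c2 * u + c3 * (1 - s - t - u)
      + d01 * (s * t) + d02 * (s * u) + d03 * (s * (1 - s - t - u))
      + d12 * (t * u) + d13 * (t * (1 - s - t - u))
      + d23 * (u * (1 - s - t - u)))) =
      (c0 * s + c1 * t + d01 * (s * t) + (c3 + d03 * s + d13 * t) * (1 - s - t)) * (1 - s - t)
      + (c2 + d02 * s + d12 * t - c3 - d03 * s - d13 * t + d23 * (1 - s - t))
          * (1 - s - t) ^ 2 / 2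
      + (-d23) * (1 - s - t) ^ 3 / 3 + 0 * (1 - s - t) ^ 4 / 4 + 0 * (1 - s - t) ^ 5 / 5 :=
    fun s t => poly4_int' _ _ _ _ _ _ _ fun u => by ring
  simp only [h1]
  have h2 : ∀ s t : ℝ, 
      (c0 * s + c1 * t + d01 * (s * t) + (c3 + d03 * s + d13 * t) * (1 - s - t)) * (1 - s - t)
      + (c2 + d02 * s + d12 * t - c3 - d03 * s - d13 * t + d23 * (1 - s - t))
          * (1 - s - t) ^ 2 / 2
      + (-d23) * (1 - s - t) ^ 3 / 3 + 0 * (1 - s - t) ^ 4 / 4 + 0 * (1 - s - t) ^ 5 / 5 =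
      (1 - s - t) * (c0 * s + c1 * t + d01 * (s * t)) + (1 - s - t) ^ 2 *
        ((c3 + c2) / 2 + (d03 + d02) / 2 * s + (d13 + d12) / 2 * t)
        + (1 - s - t) ^ 3 * (d23 / 6) := by
    intro s t; ring
  simp only [h2]
  rw [iter_int _ ((c2 + c3) / 2 + d23 / 6)
    (c0 - (c2 + c3) + (d03 + d02) / 2 - 3 * (d23 / 6))
    (c1 - (c2 + c3) + (d13 + d12) / 2 - 3 * (d23 / 6))
    (-c0 + (c2 + c3) / 2 - (d03 + d02) + 3 * (d23 / 6))
    (-c0 - c1 + d01 + (c2 + c3) - (d03 + d02) - (d13 + d12) + 6 * (d23 / 6))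
    (-c1 + (c2 + c3) / 2 - (d13 + d12) + 3 * (d23 / 6))
    ((d03 + d02) / 2 - d23 / 6)
    (-d01 + (d03 + d02) + (d13 + d12) / 2 - 3 * (d23 / 6))
    (-d01 + (d03 + d02) / 2 + (d13 + d12) - 3 * (d23 / 6))
    ((d13 + d12) / 2 - d23 / 6) (fun s t => by ring)]
  ring

/-! ### Change of variables -/

lemma param_int {F : Type*} [NormedAddCommGroup F] [NormedSpace ℝ F] [FiniteDimensional ℝ F]
    [MeasurableSpace F] [BorelSpace F] (ν : Measure F) [ν.IsAddHaarMeasure]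
    (d : ℕ) (hd : Module.finrank ℝ F = d)
    (L : F →ₗ[ℝ] E3) (hL : Function.Injective L) (a : E3) (S : Set F) (hS : IsCompact S) :
    ∃ C : ℝ, 0 < C ∧ ∀ g : E3 → ℝ,
      ∫ x in (fun z => a + L z) '' S, g x ∂μH[(d : ℝ)] = C * ∫ z in S, g (a + L z) ∂ν := by
  let W := LinearMap.range L
  let e : F ≃L[ℝ] W := (LinearEquiv.ofInjective L hL).toContinuousLinearEquiv
  have he : ∀ z, (e z : E3) = L z := fun z => rfl
  have hfr : Module.finrank ℝ W = d := by rw [← hd]; exact (e.toLinearEquiv.finrank_eq).symm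
  let μW : Measure W := μH[(d : ℝ)]
  have : μW.IsAddHaarMeasure := by
    have := isAddHaarMeasure_hausdorffMeasure (E := W)
    rw [hfr] at this
    exact this
  have : (ν.map e).IsAddHaarMeasure := e.isAddHaarMeasure_map ν
  have hme : MeasurableEmbedding e := e.toHomeomorph.measurableEmbedding
  obtain ⟨c, hc0, hc⟩ : ∃ c : NNReal, 0 < c ∧ μW = c • ν.map e :=
    ⟨_, Measure.addHaarScalarFactor_pos_of_isAddHaarMeasure μW (ν.map e),
      Measure.isAddLeftInvariant_eq_smul μW (ν.map e)⟩
  let ψ : W → E3 := fun y => a + (y : E3)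
  have hψ : Isometry ψ := by
    have := (IsometryEquiv.addLeft a).isometry.comp (isometry_subtype_coe (s := (W : Set E3)))
    exact this
  have hψe : MeasurableEmbedding ψ := by
    have hcl : Topology.IsClosedEmbedding ψ := hψ.isClosedEmbedding
    exact hcl.measurableEmbedding
  refine ⟨c, hc0, fun g => ?_⟩
  have him : (fun z => a + L z) '' S = ψ '' (e '' S) := by
    rw [Set.image_image]
    rfl
  have hmap : Measure.map ψ μW = (μH[(d : ℝ)] : Measure E3).restrict (Set.range ψ) :=
    hψ.map_hausdorffMeasure (Or.inl (by positivity))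
  have hms : MeasurableSet (ψ '' (e '' S)) :=
    ((hS.image e.continuous).image hψ.continuous).measurableSet
  have hr : (μH[(d : ℝ)] : Measure E3).restrict (ψ '' (e '' S)) =
      (Measure.map ψ μW).restrict (ψ '' (e '' S)) := by
    rw [hmap, Measure.restrict_restrict hms,
      Set.inter_eq_left.2 (Set.image_subset_range _ _)]
  rw [him, hr, hψe.setIntegral_map, Set.preimage_image_eq _ hψe.injective, hc,
    Measure.restrict_smul, integral_smul_nnreal_measure, hme.setIntegral_map,
    Set.preimage_image_eq _ hme.injective]
  rfl

lemma vol_haus : ∃ c : ℝ, 0 < c ∧ ∀ (s : Set E3) (g : E3 → ℝ),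
    ∫ x in s, g x = c * ∫ x in s, g x ∂μH[((3 : ℕ) : ℝ)] := by
  have : (μH[((3 : ℕ) : ℝ)] : Measure E3).IsAddHaarMeasure := by
    have := isAddHaarMeasure_hausdorffMeasure (E := E3)
    rw [finrank_euclideanSpace_fin] at this
    exact this
  obtain ⟨c, hc0, hc⟩ : ∃ c : NNReal, 0 < c ∧
      (volume : Measure E3) = c • (μH[((3 : ℕ) : ℝ)] : Measure E3) :=
    ⟨_, Measure.addHaarScalarFactor_pos_of_isAddHaarMeasure _ _,
      Measure.isAddLeftInvariant_eq_smul _ _⟩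
  refine ⟨c, hc0, fun s g => ?_⟩
  rw [hc, Measure.restrict_smul, integral_smul_nnreal_measure]
  rfl

def L2 (a b : E3) : ℝ × ℝ →ₗ[ℝ] E3 :=
  (LinearMap.toSpanSingleton ℝ E3 a).comp (LinearMap.fst ℝ ℝ ℝ) +
  (LinearMap.toSpanSingleton ℝ E3 b).comp (LinearMap.snd ℝ ℝ ℝ)

lemma L2_apply (a b : E3) (z : ℝ × ℝ) : L2 a b z = z.1 • a + z.2 • b := rfl

def L3 (a b c : E3) : ℝ × ℝ × ℝ →ₗ[ℝ] E3 :=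
  (LinearMap.toSpanSingleton ℝ E3 a).comp (LinearMap.fst ℝ ℝ (ℝ × ℝ)) +
  (L2 b c).comp (LinearMap.snd ℝ ℝ (ℝ × ℝ))

lemma L3_apply (a b c : E3) (z : ℝ × ℝ × ℝ) :
    L3 a b c z = z.1 • a + (z.2.1 • b + z.2.2 • c) := rfl

lemma tri_image (a b c : E3) :
    convexHull ℝ {a, b, c} = (fun z => c + L2 (a - c) (b - c) z) '' T2 := by
  apply Set.Subset.antisymm
  · refine convexHull_min ?_ ?_
    · rintro x (rfl | rfl | rfl)
      · exact ⟨(1, 0), by simp [T2], by simp [L2_apply]⟩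
      · exact ⟨(0, 1), by simp [T2], by simp [L2_apply]⟩
      · exact ⟨(0, 0), by simp [T2], by simp [L2_apply]⟩
    · have := (T2_convex.linear_image (L2 (a - c) (b - c))).vadd c
      rw [← Set.image_vadd, Set.image_image] at this
      exact this
  · rintro _ ⟨⟨s, t⟩, ⟨h1, h2, h3⟩, rfl⟩
    simp only at h1 h2 h3
    have hc := convex_convexHull ℝ ({a, b, c} : Set E3)
    have ha : a ∈ convexHull ℝ ({a, b, c} : Set E3) := subset_convexHull _ _ (by simp)
    have hb : b ∈ convexHull ℝ ({a, b, c} : Set E3) := subset_convexHull _ _ (by simp)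
    have hcc : c ∈ convexHull ℝ ({a, b, c} : Set E3) := subset_convexHull _ _ (by simp)
    have := hc.sum_mem (t := Finset.univ) (w := ![s, t, 1 - s - t]) (z := ![a, b, c])
      (by intro i _; fin_cases i <;> simp <;> linarith) (by simp [Fin.sum_univ_three])
      (by intro i _; fin_cases i <;> simp [ha, hb, hcc])
    convert this using 1
    simp only [L2_apply, Fin.sum_univ_three, Matrix.cons_val]
    module

lemma tet_image (a b c d : E3) :
    convexHull ℝ {a, b, c, d} = (fun z => d + L3 (a - d) (b - d) (c - d) z) '' T3 := by
  apply Set.Subset.antisymm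
  · refine convexHull_min ?_ ?_
    · rintro x (rfl | rfl | rfl | rfl)
      · exact ⟨(1, 0, 0), by simp [T3], by simp [L3_apply]⟩
      · exact ⟨(0, 1, 0), by simp [T3], by simp [L3_apply]⟩
      · exact ⟨(0, 0, 1), by simp [T3], by simp [L3_apply]⟩
      · exact ⟨(0, 0, 0), by simp [T3], by simp [L3_apply]⟩
    · have := (T3_convex.linear_image (L3 (a - d) (b - d) (c - d))).vadd d
      rw [← Set.image_vadd, Set.image_image] at this
      exact this
  · rintro _ ⟨⟨s, t, u⟩, ⟨h1, h2, h3, h4⟩, rfl⟩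
    simp only at h1 h2 h3 h4
    have hc := convex_convexHull ℝ ({a, b, c, d} : Set E3)
    have ha : a ∈ convexHull ℝ ({a, b, c, d} : Set E3) := subset_convexHull _ _ (by simp)
    have hb : b ∈ convexHull ℝ ({a, b, c, d} : Set E3) := subset_convexHull _ _ (by simp)
    have hcc : c ∈ convexHull ℝ ({a, b, c, d} : Set E3) := subset_convexHull _ _ (by simp)
    have hd : d ∈ convexHull ℝ ({a, b, c, d} : Set E3) := subset_convexHull _ _ (by simp)
    have := hc.sum_mem (t := Finset.univ) (w := ![s, t, u, 1 - s - t - u]) (z := ![a, b, c, d])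
      (by intro i _; fin_cases i <;> simp <;> linarith) (by simp [Fin.sum_univ_four])
      (by intro i _; fin_cases i <;> simp [ha, hb, hcc, hd])
    convert this using 1
    simp only [L3_apply, Fin.sum_univ_four, Matrix.cons_val]
    module

lemma aff_L2 (q : E3 →ᵃ[ℝ] ℝ) (a b c : E3) (z : ℝ × ℝ) :
    q (c + L2 (a - c) (b - c) z) = q a * z.1 + q b * z.2 + q c * (1 - z.1 - z.2) := by
  rw [aff_add, L2_apply, map_add, map_smul, map_smul, aff_lin, aff_lin]
  simp only [smul_eq_mul]
  ring

lemma aff_L3 (q : E3 →ᵃ[ℝ] ℝ) (a b c d : E3) (z : ℝ × ℝ × ℝ) :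
    q (d + L3 (a - d) (b - d) (c - d) z) =
      q a * z.1 + q b * z.2.1 + q c * z.2.2 + q d * (1 - z.1 - z.2.1 - z.2.2) := by
  rw [aff_add, L3_apply, map_add, map_add, map_smul, map_smul, map_smul, aff_lin, aff_lin, aff_lin]
  simp only [smul_eq_mul]
  ring

/-- Face integral, in terms of three affine functions dual to the three points. -/
lemma face_int (a b c : E3) (la lb lc : E3 →ᵃ[ℝ] ℝ)
    (haa : la a = 1) (hab : la b = 0) (hac : la c = 0)
    (hba : lb a = 0) (hbb : lb b = 1) (hbc : lb c = 0)
    (hca : lc a = 0) (hcb : lc b = 0) (hcc : lc c = 1) :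
    ∃ C : ℝ, 0 < C ∧ ∀ (p : E3 → ℝ) (x1 x2 x3 d12 d13 d23 : ℝ)
      (_ : ∀ x ∈ convexHull ℝ {a, b, c}, p x = x1 * la x + x2 * lb x + x3 * lc x
        + d12 * (la x * lb x) + d13 * (la x * lc x) + d23 * (lb x * lc x))
      (q : E3 →ᵃ[ℝ] ℝ),
      ∫ x in convexHull ℝ {a, b, c}, p x * q x ∂μH[2] =
      C * (q a * (x1 / 12 + (x2 + x3) / 24 + (2 * d12 + 2 * d13 + d23) / 120)
      + q b * (x2 / 12 + (x1 + x3) / 24 + (2 * d12 + d13 + 2 * d23) / 120)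
      + q c * (x3 / 12 + (x1 + x2) / 24 + (d12 + 2 * d13 + 2 * d23) / 120)) := by
  have hinj : Function.Injective (L2 (a - c) (b - c)) := by
    intro z y hzy
    have h1 := aff_L2 la a b c z
    have h2 := aff_L2 lb a b c z
    rw [hzy, aff_L2] at h1 h2
    simp only [haa, hab, hac, hba, hbb, hbc] at h1 h2
    ext <;> linarith
  obtain ⟨C, hC, h⟩ := param_int (volume : Measure (ℝ × ℝ)) 2 (by simp) (L2 (a - c) (b - c)) hinj c
    T2 T2_compact
  refine ⟨C, hC, fun p x1 x2 x3 d12 d13 d23 hp q => ?_⟩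
  have h' := h (fun x => p x * q x)
  rw [tri_image]
  push_cast at h'
  rw [h', ← tri_int]
  congr 1
  refine setIntegral_congr_fun T2_compact.measurableSet fun z hz => ?_
  have hmem : c + L2 (a - c) (b - c) z ∈ convexHull ℝ {a, b, c} := by
    rw [tri_image]; exact ⟨z, hz, rfl⟩
  rw [hp _ hmem, aff_L2 q, aff_L2 la, aff_L2 lb, aff_L2 lc, haa, hab, hac, hba, hbb, hbc, hca,
    hcb, hcc]
  ring

lemma Bary.tet {w lam} (h : Bary w lam) :
    ∃ C : ℝ, 0 < C ∧ ∀ (p : E3 → ℝ) (c0 c1 c2 c3 d01 d02 d03 d12 d13 d23 : ℝ)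
      (_ : ∀ x, p x =
      c0 * lam 0 x + c1 * lam 1 x + c2 * lam 2 x + c3 * lam 3 x
      + d01 * (lam 0 x * lam 1 x) + d02 * (lam 0 x * lam 2 x) + d03 * (lam 0 x * lam 3 x)
      + d12 * (lam 1 x * lam 2 x) + d13 * (lam 1 x * lam 3 x) + d23 * (lam 2 x * lam 3 x)),
      ∫ x in convexHull ℝ {w 0, w 1, w 2, w 3}, p x =
      C * ((c0 + c1 + c2 + c3) / 24 + (d01 + d02 + d03 + d12 + d13 + d23) / 120) := by
  have hinj : Function.Injective (L3 (w 0 - w 3) (w 1 - w 3) (w 2 - w 3)) := by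
    intro z y hzy
    have h0 := aff_L3 (lam 0) (w 0) (w 1) (w 2) (w 3) z
    have h1 := aff_L3 (lam 1) (w 0) (w 1) (w 2) (w 3) z
    have h2 := aff_L3 (lam 2) (w 0) (w 1) (w 2) (w 3) z
    rw [hzy, aff_L3] at h0 h1 h2
    simp [h.val] at h0 h1 h2
    ext <;> simp [*]
  have hh : (volume : Measure (ℝ × ℝ × ℝ)).IsAddHaarMeasure :=
    Measure.prod.instIsAddHaarMeasure (volume : Measure ℝ) (volume : Measure (ℝ × ℝ))
  obtain ⟨C, hC, hi⟩ := param_int (volume : Measure (ℝ × ℝ × ℝ)) 3 (by simp)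
    (L3 (w 0 - w 3) (w 1 - w 3) (w 2 - w 3)) hinj (w 3) T3 T3_compact
  obtain ⟨c, hc, hv⟩ := vol_haus
  refine ⟨c * C, mul_pos hc hC, fun p c0 c1 c2 c3 d01 d02 d03 d12 d13 d23 hp => ?_⟩
  rw [hv, tet_image, hi, ← tet_int, mul_assoc]
  congr 2
  refine setIntegral_congr_fun T3_compact.measurableSet fun z hz => ?_
  rw [hp]
  simp only [aff_L3, h.val]
  simp

theorem stmt_0 (v : Fin 4 → E3) (hv : AffineIndependent ℝ v)
    (i j k l : Fin 4) (hij : i ≠ j) (hki : k ≠ i) (hkj : k ≠ j)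
    (hli : l ≠ i) (hlj : l ≠ j) (hkl : k ≠ l) (β γ : ℝ) :
    ∃ p : E3 → ℝ, LemCond v i j k l β γ p ∧
      p (v i) = 3 * (β + γ) / 2 ∧ p (v j) = 3 * (β + γ) / 2 ∧
      ∀ p' : E3 → ℝ, LemCond v i j k l β γ p' → ∀ x ∈ Tet v, p' x = p x := by
  have hinj : Function.Injective ![i, j, k, l] := by
    intro a b h
    fin_cases a <;> fin_cases b <;> first
      | rfl
      | (exfalso; simp at h; tauto)
  have hfi : {m : Fin 4 | m ≠ i} = {j, k, l} := by
    ext m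
    simp only [Set.mem_ofPred_eq, Set.mem_insert_iff, Set.mem_singleton_iff]
    clear hinj
    revert i j k l m; decide
  have hfj : {m : Fin 4 | m ≠ j} = {i, k, l} := by
    ext m
    simp only [Set.mem_ofPred_eq, Set.mem_insert_iff, Set.mem_singleton_iff]
    clear hinj hfi
    revert i j k l m; decide
  have huniv : (Set.univ : Set (Fin 4)) = {i, j, k, l} := by
    ext m
    simp only [Set.mem_univ, Set.mem_insert_iff, Set.mem_singleton_iff]
    clear hinj hfi hfj
    revert i j k l m; decide
  have hFi : Face v i = convexHull ℝ {v j, v k, v l} := by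
    rw [Face, hfi]; simp [Set.image_insert_eq]
  have hFj : Face v j = convexHull ℝ {v i, v k, v l} := by
    rw [Face, hfj]; simp [Set.image_insert_eq]
  have hT : Tet v = convexHull ℝ {v i, v j, v k, v l} := by
    rw [Tet, ← Set.image_univ, huniv]; simp [Set.image_insert_eq]
  obtain ⟨lam, hb⟩ := exists_bary (v ∘ ![i, j, k, l]) (hv.comp_embedding ⟨_, hinj⟩)
  have e0 : (v ∘ ![i, j, k, l]) 0 = v i := rfl
  have e1 : (v ∘ ![i, j, k, l]) 1 = v j := rfl
  have e2 : (v ∘ ![i, j, k, l]) 2 = v k := rfl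
  have e3 : (v ∘ ![i, j, k, l]) 3 = v l := rfl
  have hv0 : ∀ a, lam a (v i) = if a = 0 then 1 else 0 := fun a => hb.val a 0
  have hv1 : ∀ a, lam a (v j) = if a = 1 then 1 else 0 := fun a => hb.val a 1
  have hv2 : ∀ a, lam a (v k) = if a = 2 then 1 else 0 := fun a => hb.val a 2
  have hv3 : ∀ a, lam a (v l) = if a = 3 then 1 else 0 := fun a => hb.val a 3
  obtain ⟨C, hC, htet⟩ := hb.tet
  rw [e0, e1, e2, e3, ← hT] at htet
  obtain ⟨Ci, hCi, hIi⟩ := face_int (v j) (v k) (v l) (lam 1) (lam 2) (lam 3)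
    (by simp [hv1]) (by simp [hv2]) (by simp [hv3]) (by simp [hv1]) (by simp [hv2]) (by simp [hv3])
    (by simp [hv1]) (by simp [hv2]) (by simp [hv3])
  obtain ⟨Cj, hCj, hIj⟩ := face_int (v i) (v k) (v l) (lam 0) (lam 2) (lam 3)
    (by simp [hv0]) (by simp [hv2]) (by simp [hv3]) (by simp [hv0]) (by simp [hv2]) (by simp [hv3])
    (by simp [hv0]) (by simp [hv2]) (by simp [hv3])
  -- vanishing of the opposite coordinate on the faces
  have hz0 : ∀ x ∈ convexHull ℝ {v j, v k, v l}, lam 0 x = 0 := by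
    intro x hx
    rw [tri_image] at hx
    obtain ⟨z, _, rfl⟩ := hx
    simp [aff_L2, hv1, hv2, hv3]
  have hz1 : ∀ x ∈ convexHull ℝ {v i, v k, v l}, lam 1 x = 0 := by
    intro x hx
    rw [tri_image] at hx
    obtain ⟨z, _, rfl⟩ := hx
    simp [aff_L2, hv0, hv2, hv3]
  rw [← hFi] at hIi hz0
  rw [← hFj] at hIj hz1
  have hedge : ∀ (q : E3 →ᵃ[ℝ] ℝ) (s t : ℝ), s + t = 1 →
      q (s • v k + t • v l) = s * q (v k) + t * q (v l) := by
    intro q s t hst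
    have h1 : s • v k + t • v l = v l + s • (v k - v l) := by
      have : t = 1 - s := by linarith
      subst this
      module
    rw [h1, aff_add, map_smul, aff_lin, smul_eq_mul]
    have : t = 1 - s := by linarith
    subst this
    ring
  set B := β + γ with hB
  set E2 := -(15 / 2) * β - 5 / 2 * γ with hE2
  set E3' := -(5 / 2) * β - 15 / 2 * γ with hE3
  let p : E3 → ℝ := fun x => 3 * B / 2 * lam 0 x + 3 * B / 2 * lam 1 x + β * lam 2 x + γ * lam 3 x
      + 0 * (lam 0 x * lam 1 x) + E2 * (lam 0 x * lam 2 x) + E3' * (lam 0 x * lam 3 x)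
      + E2 * (lam 1 x * lam 2 x) + E3' * (lam 1 x * lam 3 x) + 0 * (lam 2 x * lam 3 x)
  have hpdef : ∀ x, p x = 3 * B / 2 * lam 0 x + 3 * B / 2 * lam 1 x + β * lam 2 x + γ * lam 3 x
      + 0 * (lam 0 x * lam 1 x) + E2 * (lam 0 x * lam 2 x) + E3' * (lam 0 x * lam 3 x)
      + E2 * (lam 1 x * lam 2 x) + E3' * (lam 1 x * lam 3 x) + 0 * (lam 2 x * lam 3 x) :=
    fun x => rfl
  refine ⟨p, ⟨?_, ?_, ?_, ?_, ?_, ?_, ?_⟩, ?_, ?_, ?_⟩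
  · have hA : IsPolyLE 1 (fun x => (3 * B / 2) * lam 0 x + (3 * B / 2) * lam 1 x
        + β * lam 2 x + γ * lam 3 x) := by
      have := isPolyLE_affine ((3 * B / 2) • lam 0 + (3 * B / 2) • lam 1 + β • lam 2 + γ • lam 3)
      exact this
    have hD := (isPolyLE_affine (lam 0 + lam 1)).mul' (isPolyLE_affine (E2 • lam 2 + E3' • lam 3))
    have := (hA.mono' one_le_two).add' hD
    convert this using 1
    ext x
    rw [hpdef]
    simp only [AffineMap.coe_add, AffineMap.coe_smul, Pi.add_apply, Pi.smul_apply, smul_eq_mul]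
    ring
  · refine ⟨β • lam 2 + γ • lam 3, ?_⟩
    rintro _ ⟨s, t, hs, ht, hst, rfl⟩
    rw [hpdef]
    simp only [AffineMap.coe_add, AffineMap.coe_smul, Pi.add_apply, Pi.smul_apply, smul_eq_mul,
      hedge _ s t hst, hv2, hv3]
    simp
    ring
  · rw [hpdef]; simp [hv2]
  · rw [hpdef]; simp [hv3]
  · intro q
    rw [hIi p (3 * B / 2) β γ E2 E3' 0 (fun x hx => by rw [hpdef, hz0 x hx]; ring)]
    rw [hE2, hE3, hB]; ring
  · intro q
    rw [hIj p (3 * B / 2) β γ E2 E3' 0 (fun x hx => by rw [hpdef, hz1 x hx]; ring)]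
    rw [hE2, hE3, hB]; ring
  · rw [htet p _ _ _ _ _ _ _ _ _ _ hpdef, hE2, hE3, hB]; ring
  · rw [hpdef]; simp [hv0]
  · rw [hpdef]; simp [hv1]
  · rintro p' ⟨hpoly, ⟨qe, hqe⟩, hk, hl, hi, hj, hK⟩ x _
    obtain ⟨c0, c1, c2, c3, d01, d02, d03, d12, d13, d23, hp'⟩ := hb.quad' hpoly
    have hc2 : c2 = β := by rw [← hk, hp']; simp [hv2]
    have hc3 : c3 = γ := by rw [← hl, hp']; simp [hv3]
    have hd23 : d23 = 0 := by
      have m1 := hqe (v k) (left_mem_segment ℝ _ _)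
      have m2 := hqe (v l) (right_mem_segment ℝ _ _)
      have m3 := hqe ((1 / 2 : ℝ) • v k + (1 / 2 : ℝ) • v l)
        ⟨1 / 2, 1 / 2, by norm_num, by norm_num, by norm_num, rfl⟩
      rw [hedge qe _ _ (by norm_num), ← m1, ← m2, hk, hl, hp'] at m3
      simp only [hedge _ (1 / 2) (1 / 2) (by norm_num), hv2, hv3, hc2, hc3] at m3
      simp at m3
      linarith
    have gi : ∀ q : E3 →ᵃ[ℝ] ℝ, _ := fun q => (hIi p' c1 c2 c3 d12 d13 d23
      (fun x hx => by rw [hp', hz0 x hx]; ring) q).symm.trans (hi q)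
    have gj : ∀ q : E3 →ᵃ[ℝ] ℝ, _ := fun q => (hIj p' c0 c2 c3 d02 d03 d23
      (fun x hx => by rw [hp', hz1 x hx]; ring) q).symm.trans (hj q)
    have gK := (htet p' _ _ _ _ _ _ _ _ _ _ hp').symm.trans hK
    have i1 := (mul_eq_zero.1 (gi (lam 1))).resolve_left hCi.ne'
    have i2 := (mul_eq_zero.1 (gi (lam 2))).resolve_left hCi.ne'
    have i3 := (mul_eq_zero.1 (gi (lam 3))).resolve_left hCi.ne'
    have j1 := (mul_eq_zero.1 (gj (lam 0))).resolve_left hCj.ne'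
    have j2 := (mul_eq_zero.1 (gj (lam 2))).resolve_left hCj.ne'
    have j3 := (mul_eq_zero.1 (gj (lam 3))).resolve_left hCj.ne'
    have k1 := (mul_eq_zero.1 gK).resolve_left hC.ne'
    simp only [hv0, hv1, hv2, hv3, hc2, hc3, hd23] at i1 i2 i3 j1 j2 j3 k1
    simp at i1 i2 i3 j1 j2 j3
    have a1 : c1 = 3 * B / 2 := by linarith
    have a0 : c0 = 3 * B / 2 := by linarith
    have a12 : d12 = E2 := by linarith
    have a13 : d13 = E3' := by linarith
    have a02 : d02 = E2 := by linarith
    have a03 : d03 = E3' := by linarith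
    have a01 : d01 = 0 := by linarith
    rw [hp', hpdef, a0, a1, hc2, hc3, a12, a13, a02, a03, a01, hd23]
end
end

section
/- For real numbers a, b, let M(a,b) be the 12×12 real matrix whose rows and columns are indexed by the 12 ordered pairs (i,k) of distinct indices in {1,2,3,4} (ordered lexicographically), where the row indexed by (i,k) has the entry a in the columns indexed by (l,j) and (j,l), the entry b in the columns indexed by (l,k) and (j,k), and 0 in all other columns; here j and l denote the two indices in {1,2,3,4} \ {i,k}. Then det M(a,b) = 16 (2a − b)² b⁶ (a + b)⁴. In particular, for a = 3 and b = 2 the matrix M(a,b) is nonsingular, so the only solution (β_{lk})_{(l,k)} of the homogeneous linear system: a(β_{lj} + β_{jl}) + b(β_{lk} + β_{jk}) = 0 for each ordered pair (i,k) of distinct indices (with {j,l} = {1,2,3,4} \ {i,k}), is β_{lk} = 0 for all pairs. -/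
noncomputable section

/-- The index set of the 12 ordered pairs of distinct indices in {1,2,3,4}. -/
abbrev PairIdx := {p : Fin 4 × Fin 4 // p.1 ≠ p.2}

/-- The 12×12 matrix of the linear system: the row indexed by the pair `(i,k)` has
entry `a` in the columns `(l,j)` and `(j,l)`, entry `b` in the columns `(l,k)` and
`(j,k)` (where `{j,l} = {1,2,3,4} \ {i,k}`), and `0` elsewhere. -/
def Msys (a b : ℝ) : Matrix PairIdx PairIdx ℝ := fun r c =>
  if c.1.2 = r.1.2 ∧ c.1.1 ≠ r.1.1 then b
  else if c.1.1 ≠ r.1.1 ∧ c.1.1 ≠ r.1.2 ∧ c.1.2 ≠ r.1.1 ∧ c.1.2 ≠ r.1.2 then a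
  else 0

def zA : Matrix (Fin 12) (Fin 12) ℤ :=
  !![0, 0, 0, 0, 0, 0, 0, 0, 1, 0, 0, 1;
    0, 0, 0, 0, 0, 1, 0, 0, 0, 0, 1, 0;
    0, 0, 0, 0, 1, 0, 0, 1, 0, 0, 0, 0;
    0, 0, 0, 0, 0, 0, 0, 0, 1, 0, 0, 1;
    0, 0, 1, 0, 0, 0, 0, 0, 0, 1, 0, 0;
    0, 1, 0, 0, 0, 0, 1, 0, 0, 0, 0, 0;
    0, 0, 0, 0, 0, 1, 0, 0, 0, 0, 1, 0;
    0, 0, 1, 0, 0, 0, 0, 0, 0, 1, 0, 0;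
    1, 0, 0, 1, 0, 0, 0, 0, 0, 0, 0, 0;
    0, 0, 0, 0, 1, 0, 0, 1, 0, 0, 0, 0;
    0, 1, 0, 0, 0, 0, 1, 0, 0, 0, 0, 0;
    1, 0, 0, 1, 0, 0, 0, 0, 0, 0, 0, 0]

def zB : Matrix (Fin 12) (Fin 12) ℤ :=
  !![0, 1, 1, 0, 0, 0, 0, 0, 0, 0, 0, 0;
    1, 0, 1, 0, 0, 0, 0, 0, 0, 0, 0, 0;
    1, 1, 0, 0, 0, 0, 0, 0, 0, 0, 0, 0;
    0, 0, 0, 0, 1, 1, 0, 0, 0, 0, 0, 0;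
    0, 0, 0, 1, 0, 1, 0, 0, 0, 0, 0, 0;
    0, 0, 0, 1, 1, 0, 0, 0, 0, 0, 0, 0;
    0, 0, 0, 0, 0, 0, 0, 1, 1, 0, 0, 0;
    0, 0, 0, 0, 0, 0, 1, 0, 1, 0, 0, 0;
    0, 0, 0, 0, 0, 0, 1, 1, 0, 0, 0, 0;
    0, 0, 0, 0, 0, 0, 0, 0, 0, 0, 1, 1;
    0, 0, 0, 0, 0, 0, 0, 0, 0, 1, 0, 1;
    0, 0, 0, 0, 0, 0, 0, 0, 0, 1, 1, 0]

def zQ : Matrix (Fin 12) (Fin 12) ℤ :=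
  !![0, 1, -1, 0, 0, 0, 0, 0, 0, 0, 1, 0;
    1, 0, 0, -1, 0, 0, 0, 0, 0, 0, 0, 1;
    -1, -1, 0, 0, 0, -1, 0, 0, 1, 0, 0, 0;
    0, 1, 1, 0, 0, 0, 0, 0, 0, 1, 0, 0;
    -1, -1, 0, 0, -1, 0, 0, 0, 0, 0, 0, 1;
    1, 0, 0, 0, 0, 0, -1, 0, 1, 0, 0, 0;
    1, 0, 0, 1, 0, 0, 0, 0, 0, 1, 0, 0;
    -1, -1, 0, 0, 1, 0, 0, 0, 0, 0, 1, 0;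
    0, 1, 0, 0, 0, 0, 0, -1, 1, 0, 0, 0;
    -1, -1, 0, 0, 0, 1, 0, 0, 0, 1, 0, 0;
    1, 0, 0, 0, 0, 0, 1, 0, 0, 0, 1, 0;
    0, 1, 0, 0, 0, 0, 0, 1, 0, 0, 0, 1]

def zR : Matrix (Fin 12) (Fin 12) ℤ :=
  !![-1, 2, -1, -1, -1, 2, 2, -1, -1, -1, 2, -1;
    2, -1, -1, 2, -1, -1, -1, -1, 2, -1, -1, 2;
    -6, -3, -3, 6, 3, 3, -3, 3, 0, -3, 3, 0;
    -3, -6, -3, -3, 3, 0, 6, 3, 3, -3, 0, 3;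
    -3, 3, 0, -3, -6, -3, 3, 6, 3, 0, -3, 3;
    -3, -3, -6, -3, 0, 3, -3, 0, 3, 6, 3, 3;
    -3, 0, 3, -3, -3, -6, 0, -3, 3, 3, 6, 3;
    0, -3, 3, 0, -3, 3, -3, -3, -6, 3, 3, 6;
    -2, -2, 4, -2, -2, 4, -2, -2, 4, 4, 4, 4;
    4, 4, 4, 4, -2, -2, 4, -2, -2, 4, -2, -2;
    4, -2, -2, 4, 4, 4, -2, 4, -2, -2, 4, -2;
    -2, 4, -2, -2, 4, -2, 4, 4, 4, -2, -2, 4]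

def zJ : Matrix (Fin 12) (Fin 12) ℤ :=
  !![-2, 0, 0, 0, 0, 0, 0, 0, 0, 0, 0, 0;
    0, -2, 0, 0, 0, 0, 0, 0, 0, 0, 0, 0;
    0, 0, 0, 0, 0, 0, 0, 0, 0, 0, 0, 0;
    0, 0, 0, 0, 0, 0, 0, 0, 0, 0, 0, 0;
    0, 0, 0, 0, 0, 0, 0, 0, 0, 0, 0, 0;
    0, 0, 0, 0, 0, 0, 0, 0, 0, 0, 0, 0;
    0, 0, 0, 0, 0, 0, 0, 0, 0, 0, 0, 0;
    0, 0, 0, 0, 0, 0, 0, 0, 0, 0, 0, 0;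
    0, 0, 0, 0, 0, 0, 0, 0, 1, 0, 0, 0;
    0, 0, 0, 0, 0, 0, 0, 0, 0, 1, 0, 0;
    0, 0, 0, 0, 0, 0, 0, 0, 0, 0, 1, 0;
    0, 0, 0, 0, 0, 0, 0, 0, 0, 0, 0, 1]

def zf : Fin 12 → PairIdx :=
  ![⟨(1,0), by decide⟩, ⟨(2,0), by decide⟩, ⟨(3,0), by decide⟩, ⟨(0,1), by decide⟩, ⟨(2,1), by decide⟩, ⟨(3,1), by decide⟩, ⟨(0,2), by decide⟩, ⟨(1,2), by decide⟩, ⟨(3,2), by decide⟩, ⟨(0,3), by decide⟩, ⟨(1,3), by decide⟩, ⟨(2,3), by decide⟩]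

def ze : Fin 12 ≃ PairIdx := Equiv.ofBijective zf (by
  constructor
  · decide
  · decide)

set_option maxRecDepth 100000

theorem zAQ : zA * zQ = zB * zQ * zJ := by decide +kernel

theorem zRQ : zR * zQ = (12 : ℤ) • (1 : Matrix (Fin 12) (Fin 12) ℤ) := by decide +kernel

def zent (M : Matrix (Fin 12) (Fin 12) ℤ) (i j : Fin 12) : ℤ := M i j

theorem zent_eq (M : Matrix (Fin 12) (Fin 12) ℤ) (i j : Fin 12) : zent M i j = M i j := rfl

theorem zJ_tri : ∀ i j : Fin 12, i ≤ j ∨ zent zJ i j = 0 := by decide +kernel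

def zK : Matrix (Fin 3) (Fin 3) ℤ := !![0, 1, 1; 1, 0, 1; 1, 1, 0]

def zp : Fin 3 × Fin 4 ≃ Fin 12 := (Equiv.prodComm _ _).trans finProdFinEquiv

theorem zB_block : zB.submatrix zp zp = Matrix.blockDiagonal (fun _ : Fin 4 => zK) := by
  decide +kernel

theorem zB_det : zB.det = 16 := by
  rw [← Matrix.det_submatrix_equiv_self zp zB, zB_block, Matrix.det_blockDiagonal]
  simp [zK, Matrix.det_fin_three]

theorem zQ_det : zQ.det ≠ 0 := by
  intro h
  have := congrArg Matrix.det zRQ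
  rw [Matrix.det_mul, h, Matrix.det_smul, Matrix.det_one] at this
  simp at this

def zc (M : Matrix (Fin 12) (Fin 12) ℤ) : Matrix (Fin 12) (Fin 12) ℝ := (Int.castRingHom ℝ).mapMatrix M

theorem zM_entries : ∀ i j : Fin 12,
    (((zf j).1.2 = (zf i).1.2 ∧ (zf j).1.1 ≠ (zf i).1.1) ∧ zent zA i j = 0 ∧ zent zB i j = 1) ∨
    (¬ ((zf j).1.2 = (zf i).1.2 ∧ (zf j).1.1 ≠ (zf i).1.1) ∧
      ((zf j).1.1 ≠ (zf i).1.1 ∧ (zf j).1.1 ≠ (zf i).1.2 ∧ (zf j).1.2 ≠ (zf i).1.1 ∧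
        (zf j).1.2 ≠ (zf i).1.2) ∧ zent zA i j = 1 ∧ zent zB i j = 0) ∨
    (¬ ((zf j).1.2 = (zf i).1.2 ∧ (zf j).1.1 ≠ (zf i).1.1) ∧
      ¬ ((zf j).1.1 ≠ (zf i).1.1 ∧ (zf j).1.1 ≠ (zf i).1.2 ∧ (zf j).1.2 ≠ (zf i).1.1 ∧
        (zf j).1.2 ≠ (zf i).1.2) ∧ zent zA i j = 0 ∧ zent zB i j = 0) := by
  decide +kernel

theorem zM_eq (a b : ℝ) : (Msys a b).submatrix ze ze = a • zc zA + b • zc zB := by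
  ext i j
  have hz : ∀ i, ze i = zf i := fun _ => rfl
  simp only [Matrix.submatrix_apply, hz, Msys, Matrix.add_apply, Matrix.smul_apply, zc,
    RingHom.mapMatrix_apply, Matrix.map_apply]
  have hent := zM_entries i j
  simp only [zent_eq] at hent
  rcases hent with ⟨h1, h2, h3⟩ | ⟨h0, h1, h2, h3⟩ | ⟨h0, h1, h2, h3⟩
  · rw [if_pos h1, h2, h3]; simp
  · rw [if_neg h0, if_pos h1, h2, h3]; simp
  · rw [if_neg h0, if_neg h1, h2, h3]; simp

theorem zJ_det (a b : ℝ) : (a • zc zJ + b • (1 : Matrix (Fin 12) (Fin 12) ℝ)).det =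
    (b - 2 * a) ^ 2 * b ^ 6 * (a + b) ^ 4 := by
  rw [Matrix.det_of_isUpperTriangular]
  · simp [Fin.prod_univ_succ, zc, zJ]
    ring
  · intro i j hij
    have hij' : j < i := hij
    have h0 : zJ i j = 0 := (zJ_tri i j).resolve_left hij'.not_ge
    simp [zc, h0, Matrix.one_apply_ne hij'.ne']

theorem z_det (a b : ℝ) :
    (Msys a b).det = 16 * (2 * a - b) ^ 2 * b ^ 6 * (a + b) ^ 4 := by
  rw [← Matrix.det_submatrix_equiv_self ze, zM_eq]
  have hAQ : zc zA * zc zQ = zc zB * zc zQ * zc zJ := by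
    simp only [zc, ← map_mul, zAQ]
  have key : (a • zc zA + b • zc zB) * zc zQ =
      zc zB * zc zQ * (a • zc zJ + b • (1 : Matrix (Fin 12) (Fin 12) ℝ)) := by
    rw [add_mul, mul_add, smul_mul_assoc, smul_mul_assoc, hAQ, mul_smul_comm, mul_smul_comm, mul_one]
  have hd := congrArg Matrix.det key
  have hB : (zc zB).det = 16 := by
    rw [zc, ← RingHom.map_det, zB_det]; simp
  have hQ : (zc zQ).det ≠ 0 := by
    rw [zc, ← RingHom.map_det]; simpa using zQ_det
  rw [Matrix.det_mul, Matrix.det_mul, Matrix.det_mul, hB, zJ_det] at hd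
  apply mul_right_cancel₀ hQ
  rw [hd]; ring

/-- The determinant of the 12×12 system matrix is `16 (2a − b)² b⁶ (a + b)⁴`; in
particular, for `a = 3`, `b = 2` the matrix is nonsingular, so the only solution of
the homogeneous system `a(β_{lj} + β_{jl}) + b(β_{lk} + β_{jk}) = 0` (one equation
for each ordered pair `(i,k)` of distinct indices, with `{j,l} = {1,2,3,4} \ {i,k}`)
is `β ≡ 0`. -/
theorem stmt_3 :
    (∀ a b : ℝ, (Msys a b).det = 16 * (2 * a - b) ^ 2 * b ^ 6 * (a + b) ^ 4) ∧
    (Msys 3 2).det ≠ 0 ∧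
    (∀ β : Fin 4 → Fin 4 → ℝ,
      (∀ i k j l : Fin 4, i ≠ k → j ≠ i → j ≠ k → l ≠ i → l ≠ k → j ≠ l →
        3 * (β l j + β j l) + 2 * (β l k + β j k) = 0) →
      ∀ l k : Fin 4, l ≠ k → β l k = 0) := by
  refine ⟨z_det, ?_, ?_⟩
  · rw [z_det]; norm_num
  · intro β h
    have h10 := h 1 0 2 3 (by decide) (by decide) (by decide) (by decide) (by decide) (by decide)
    have h20 := h 2 0 1 3 (by decide) (by decide) (by decide) (by decide) (by decide) (by decide)
    have h30 := h 3 0 1 2 (by decide) (by decide) (by decide) (by decide) (by decide) (by decide)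
    have h01 := h 0 1 2 3 (by decide) (by decide) (by decide) (by decide) (by decide) (by decide)
    have h21 := h 2 1 0 3 (by decide) (by decide) (by decide) (by decide) (by decide) (by decide)
    have h31 := h 3 1 0 2 (by decide) (by decide) (by decide) (by decide) (by decide) (by decide)
    have h02 := h 0 2 1 3 (by decide) (by decide) (by decide) (by decide) (by decide) (by decide)
    have h12 := h 1 2 0 3 (by decide) (by decide) (by decide) (by decide) (by decide) (by decide)
    have h32 := h 3 2 0 1 (by decide) (by decide) (by decide) (by decide) (by decide) (by decide)
    have h03 := h 0 3 1 2 (by decide) (by decide) (by decide) (by decide) (by decide) (by decide)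
    have h13 := h 1 3 0 2 (by decide) (by decide) (by decide) (by decide) (by decide) (by decide)
    have h23 := h 2 3 0 1 (by decide) (by decide) (by decide) (by decide) (by decide) (by decide)
    intro l k hlk
    fin_cases l <;> fin_cases k <;> first | exact absurd rfl hlk | (simp only [Fin.zero_eta, Fin.mk_one, Fin.reduceFinMk]; linarith)
end
end
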